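/- Let n ≥ 1, let f : (Fin n → Bool) → Bool be a feedback function with Fibonacci transition map F_f, let x₀ be an initial state, and let s = outF f x₀ be the output sequence. Then for every p : ℕ, p is a period of the output sequence if and only if it is a period of the state trajectory: (∀ t, s (t + p) = s t) ↔ (∀ t, F_f^[t + p] x₀ = F_f^[t] x₀). In particular, for a Fibonacci FSR the period of the state trajectory equals the period of the corresponding output sequence. -/

import Mathlib

/-- The Fibonacci transition map `F_f` of an `n`-stage FSR with feedback function `f`:
`(F_f x) i = x (i+1)` when `(i : ℕ) + 1 < n`, and `(F_f x) i = f x` when `(i : ℕ) + 1 = n`. -/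
def fibStep (n : ℕ) (f : (Fin n → Bool) → Bool) (x : Fin n → Bool) : Fin n → Bool :=
  fun i => if h : (i : ℕ) + 1 < n then x ⟨(i : ℕ) + 1, h⟩ else f x

/-- The output sequence of the `n`-stage Fibonacci FSR with feedback `f` from initial state `x₀`. -/
def outF (n : ℕ) (hn : 0 < n) (f : (Fin n → Bool) → Bool) (x₀ : Fin n → Bool) (t : ℕ) : Bool :=
  (fibStep n f)^[t] x₀ ⟨0, hn⟩

/-- The output sequence of an `n`-stage (Galois) FSR with transition map `G` from initial state `z₀`. -/
def outG (n : ℕ) (hn : 0 < n) (G : (Fin n → Bool) → (Fin n → Bool)) (z₀ : Fin n → Bool) (t : ℕ) : Bool :=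
  (G^[t] z₀) ⟨0, hn⟩

/-- Stage `i` of the state at time `t` is the output at time `t + i`. -/
theorem fibStep_iterate_apply (n : ℕ) (hn : 0 < n) (f : (Fin n → Bool) → Bool)
    (x₀ : Fin n → Bool) (t i : ℕ) (hi : i < n) :
    (fibStep n f)^[t] x₀ ⟨i, hi⟩ = outF n hn f x₀ (t + i) := by
  induction i generalizing t with
  | zero => rfl
  | succ i ih =>
    rw [← Nat.add_assoc, Nat.add_right_comm, ← ih (t + 1) (by omega), Function.iterate_succ_apply']
    simp [fibStep, hi]

/-- For a Fibonacci FSR, `p` is a period of the output sequence iff it is a period of the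
state trajectory; in particular the two periods coincide. -/
theorem fibonacci_output_period_iff_state_period (n : ℕ) (hn : 1 ≤ n)
    (f : (Fin n → Bool) → Bool) (x₀ : Fin n → Bool) (p : ℕ) :
    (∀ t : ℕ, outF n hn f x₀ (t + p) = outF n hn f x₀ t) ↔
      (∀ t : ℕ, (fibStep n f)^[t + p] x₀ = (fibStep n f)^[t] x₀) := by
  refine ⟨fun h t => ?_, fun h t => congrFun (h t) ⟨0, hn⟩⟩
  ext ⟨i, hi⟩
  rw [fibStep_iterate_apply n hn, fibStep_iterate_apply n hn, Nat.add_right_comm, h]
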